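/- arXiv:2403.12148 — 2 statements merged into one kernel-verified Lean document; each statement's English description precedes it below -/
import Mathlib

section
/- For real parameters c1, c2, c3, an integer N ≥ 0, and integers n, x with 0 ≤ n ≤ N and 0 ≤ x ≤ N, the renormalized Racah polynomials satisfy the contiguity recurrence relation λ⁺(x; c_{12}; N) · p_n(x; c1,c2,c3; N) = C⁺_{n+1}(c2,c3; N) · p_{n+1}(x; c1,c2,c3; N+1) − Σ⁺_n(c2,c3; N) · p_n(x; c1,c2,c3; N+1) + A⁺_{n−1}(c2,c3; N) · p_{n−1}(x; c1,c2,c3; N+1). -/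
open Finset

noncomputable section

/-- Pochhammer symbol `(a)_k = a (a+1) ⋯ (a+k-1)`. -/
def poch (a : ℝ) (k : ℕ) : ℝ := ∏ i ∈ Finset.range k, (a + i)

/-- A real number is *generic* if it is not an integer. -/
def Generic (r : ℝ) : Prop := ∀ m : ℤ, r ≠ (m : ℝ)

/-- Genericity for three parameters: none of the parameters, nor any sum of two or three
of them, is an integer; this guarantees that no denominator vanishes. -/
def Generic3 (c1 c2 c3 : ℝ) : Prop :=
  Generic c1 ∧ Generic c2 ∧ Generic c3 ∧
  Generic (c1+c2) ∧ Generic (c1+c3) ∧ Generic (c2+c3) ∧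
  Generic (c1+c2+c3)

/-- Genericity for four parameters: none of the parameters, nor any sum of two, three or
four of them, is an integer; this guarantees that no denominator vanishes. -/
def Generic4 (c1 c2 c3 c4 : ℝ) : Prop :=
  Generic c1 ∧ Generic c2 ∧ Generic c3 ∧ Generic c4 ∧
  Generic (c1+c2) ∧ Generic (c1+c3) ∧ Generic (c1+c4) ∧
  Generic (c2+c3) ∧ Generic (c2+c4) ∧ Generic (c3+c4) ∧
  Generic (c1+c2+c3) ∧ Generic (c1+c2+c4) ∧ Generic (c1+c3+c4) ∧ Generic (c2+c3+c4) ∧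
  Generic (c1+c2+c3+c4)

/-- Normalization `Ω(n; c1,c2,c3; M)`. -/
def Om (n : ℤ) (c1 c2 c3 : ℝ) (M : ℤ) : ℝ :=
  (M.toNat.choose n.toNat : ℝ) * (2*(n:ℝ) + c2 + c3 + 1) *
    poch (c2+1) n.toNat * poch ((M:ℝ)+2+c1+c2+c3) n.toNat * poch (c1+1) (M-n).toNat /
    (poch (c3+1) n.toNat * poch (c2+c3+(n:ℝ)+1) (M.toNat+1))

/-- The renormalized Racah polynomial `p_n(x; c1,c2,c3; M)`, with the convention that it
vanishes unless `0 ≤ n ≤ M`. -/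
def racah (n : ℤ) (x : ℝ) (c1 c2 c3 : ℝ) (M : ℤ) : ℝ :=
  if 0 ≤ n ∧ n ≤ M then
    Om n c1 c2 c3 M *
      ∑ k ∈ Finset.range (n.toNat + 1),
        (poch (-(n:ℝ)) k * poch ((n:ℝ)+c2+c3+1) k * poch (-x) k * poch (x+c1+c2+1) k) /
        (poch (c2+1) k * poch ((M:ℝ)+2+c1+c2+c3) k * poch (-(M:ℝ)) k * (Nat.factorial k : ℝ))
  else 0

/-- Weight `Λ(x; c1,c2; M)`. -/
def Lam (x : ℤ) (c1 c2 : ℝ) (M : ℤ) : ℝ :=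
  (-1:ℝ)^x.toNat * (M.toNat.choose x.toNat : ℝ) * (2*(x:ℝ)+c1+c2+1) * poch (c2+1) x.toNat /
    (poch (c1+1) x.toNat * poch ((x:ℝ)+c1+c2+1) (M.toNat+1))

/-- `λ(x; c) = x(x+c+1)`. -/
def lam (x c : ℝ) : ℝ := x*(x+c+1)

/-- `μ_n(c) = n(n+c+1)`. -/
def mu (n c : ℝ) : ℝ := n*(n+c+1)

/-- Recurrence coefficient `A_n(c1,c2,c3; M)`. -/
def coefA (n c1 c2 c3 M : ℝ) : ℝ :=
  (n-M)*(n+c1+c2+c3+M+2)*(n+c2+1)*(n+c2+c3+1)/((2*n+c2+c3+1)*(2*n+c2+c3+2))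

/-- Recurrence coefficient `C_n(c1,c2,c3; M)`. -/
def coefC (n c1 c2 c3 M : ℝ) : ℝ :=
  n*(n-c1-M-1)*(n+c2+c3+M+1)*(n+c3)/((2*n+c2+c3)*(2*n+c2+c3+1))

/-- `Σ_n = A_n + C_n`. -/
def coefSig (n c1 c2 c3 M : ℝ) : ℝ := coefA n c1 c2 c3 M + coefC n c1 c2 c3 M

/-- Difference coefficient `B(x; c1,c2,c3; M)`. -/
def coefB (x c1 c2 c3 M : ℝ) : ℝ :=
  (x-M)*(x+c2+1)*(x+c1+c2+c3+M+2)*(x+c1+c2+1)/((2*x+c1+c2+1)*(2*x+c1+c2+2))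

/-- Difference coefficient `D(x; c1,c2,c3; M)`. -/
def coefD (x c1 c2 c3 M : ℝ) : ℝ :=
  x*(x+c1)*(x-c3-M-1)*(x+c1+c2+M+1)/((2*x+c1+c2)*(2*x+c1+c2+1))

/-- `S = B + D`. -/
def coefS (x c1 c2 c3 M : ℝ) : ℝ := coefB x c1 c2 c3 M + coefD x c1 c2 c3 M

/-- `F(x; c1,c2)`. -/
def Ffun (x c1 c2 : ℝ) : ℝ :=
  (x+c2+1)*(x+c1+c2+1)/((2*x+c1+c2+1)*(2*x+c1+c2+2))

/-- `λ⁺(x; c12; M) = (x+c12+M+2)(x−M−1)`. -/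
def lamP (x c12 M : ℝ) : ℝ := (x+c12+M+2)*(x-M-1)

/-- `A⁺_n(c2,c3; M)`. -/
def Ap (n c2 c3 M : ℝ) : ℝ := -(n-M-1)*(n-M)*Ffun n c3 c2

/-- `C⁺_n(c2,c3; M) = A⁺_{−n−c23−1}(c2,c3; M)`. -/
def Cp (n c2 c3 M : ℝ) : ℝ := Ap (-n-c2-c3-1) c2 c3 M

/-- `Σ⁺_n = A⁺_n + C⁺_n + (M+1)(M+1+c3)`. -/
def Sp (n c2 c3 M : ℝ) : ℝ := Ap n c2 c3 M + Cp n c2 c3 M + (M+1)*(M+1+c3)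

/-- `λ⁻(x; c123, c3; M) = (x+c123+M+1)(x−M−c3)`. -/
def lamM (x c123 c3 M : ℝ) : ℝ := (x+c123+M+1)*(x-M-c3)

/-- `A⁻_n(c1,c2,c3; M)`. -/
def Am (n c1 c2 c3 M : ℝ) : ℝ := -(n+c1+c2+c3+M+1)*(n+c1+c2+c3+M+2)*Ffun n c3 c2

/-- `C⁻_n(c1,c2,c3; M) = A⁻_{−n−c23−1}(c1,c2,c3; M)`. -/
def Cm (n c1 c2 c3 M : ℝ) : ℝ := Am (-n-c2-c3-1) c1 c2 c3 M

/-- `Σ⁻_n = A⁻_n + C⁻_n + (M+c12+1)(M+c123+1)`. -/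
def Sm (n c1 c2 c3 M : ℝ) : ℝ :=
  Am n c1 c2 c3 M + Cm n c1 c2 c3 M + (M+c1+c2+1)*(M+c1+c2+c3+1)

/-- `μ⁺_n(c123, c1; M) = (n+c123+M+2)(n−M−1−c1)`. -/
def muP (n c123 c1 M : ℝ) : ℝ := (n+c123+M+2)*(n-M-1-c1)

/-- `B⁺(x; c1,c2,c3; M)`. -/
def Bp (x c1 c2 c3 M : ℝ) : ℝ := -(x+c1+c2+c3+M+2)*(x+c1+c2+c3+M+3)*Ffun x c1 c2

/-- `D⁺(x; c1,c2,c3; M) = B⁺(−x−c12−1; c1,c2,c3; M)`. -/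
def Dp (x c1 c2 c3 M : ℝ) : ℝ := Bp (-x-c1-c2-1) c1 c2 c3 M

/-- `S⁺ = B⁺ + D⁺ + (c23+M+2)(c123+M+2)`. -/
def SpD (x c1 c2 c3 M : ℝ) : ℝ :=
  Bp x c1 c2 c3 M + Dp x c1 c2 c3 M + (c2+c3+M+2)*(c1+c2+c3+M+2)

/-- `μ⁻_n(c23; M) = (n−M)(n+c23+M+1)`. -/
def muM (n c23 M : ℝ) : ℝ := (n-M)*(n+c23+M+1)

/-- `B⁻(x; c1,c2; M)`. -/
def Bm (x c1 c2 M : ℝ) : ℝ := -(x-M)*(x-M+1)*Ffun x c1 c2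

/-- `D⁻(x; c1,c2; M) = B⁻(−x−c12−1; c1,c2; M)`. -/
def Dm (x c1 c2 M : ℝ) : ℝ := Bm (-x-c1-c2-1) c1 c2 M

/-- `S⁻ = B⁻ + D⁻ + M(c1+M)`. -/
def SmD (x c1 c2 M : ℝ) : ℝ := Bm x c1 c2 M + Dm x c1 c2 M + M*(c1+M)

/-- Nine-point recurrence coefficients `A^{e,e'}_{i,j}(c1,c2,c3,c4)` (with
`c0 = −2N−3−c1−c2−c3−c4`). -/
def nineA (e e' : ℤ) (i j : ℝ) (c1 c2 c3 c4 N : ℝ) : ℝ :=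
  let c0 : ℝ := -2*N-3-c1-c2-c3-c4
  if e = 1 ∧ e' = 1 then -(Ffun (-j-c0-c4-1) c4 c0) * Cm i c1 c2 c3 (N-j+1)
  else if e = 0 ∧ e' = 1 then (Ffun (-j-c0-c4-1) c4 c0) * Sm i c1 c2 c3 (N-j+1)
  else if e = -1 ∧ e' = 1 then -(Ffun (-j-c0-c4-1) c4 c0) * Am i c1 c2 c3 (N-j+1)
  else if e = 1 ∧ e' = -1 then -(Ffun j c4 c0) * Cp i c2 c3 (N-j-1)
  else if e = 0 ∧ e' = -1 then (Ffun j c4 c0) * Sp i c2 c3 (N-j-1)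
  else if e = -1 ∧ e' = -1 then -(Ffun j c4 c0) * Ap i c2 c3 (N-j-1)
  else if e = 1 ∧ e' = 0 then (Ffun j c4 c0 + Ffun (-j-c0-c4-1) c4 c0) * coefC i c1 c2 c3 (N-j)
  else if e = 0 ∧ e' = 0 then
    -(Ffun j c4 c0 + Ffun (-j-c0-c4-1) c4 c0) *
      (coefSig i c1 c2 c3 (N-j) + (N-j)^2 + (c1+c2+c3+2)*(N-j) + (1/2)*(c3+1)*(c1+c2+c3+1))
  else if e = -1 ∧ e' = 0 then (Ffun j c4 c0 + Ffun (-j-c0-c4-1) c4 c0) * coefA i c1 c2 c3 (N-j)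
  else 0

/-- `Γ^{0,0}_{i,j}(c1,c2,c3,c4)`. -/
def gam00 (i j : ℝ) (c1 c2 c3 c4 N : ℝ) : ℝ :=
  let c0 : ℝ := -2*N-3-c1-c2-c3-c4
  (-(coefSig i c1 c2 c3 (N-j)) + coefSig j c1 c0 c4 (N-i) - (1/4)*(c3^2-c4^2)
    + (i-N-(1/2)*(c4+1))*(i+(1/2)*(c2+c3-c0-c1))
    - (j-N-(1/2)*(c3+1))*(j+(1/2)*(c0+c4-c1-c2)))

/-- `Γ^{e,e'}_{i,j}` coefficients. -/
def gam (e e' : ℤ) (i j : ℝ) (c1 c2 c3 c4 N : ℝ) : ℝ :=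
  let c0 : ℝ := -2*N-3-c1-c2-c3-c4
  if e = 0 ∧ e' = 1 then coefC j c1 c0 c4 (N-i)
  else if e = 0 ∧ e' = -1 then coefA j c1 c0 c4 (N-i)
  else if e = 1 ∧ e' = 0 then coefC i c1 c2 c3 (N-j)
  else if e = -1 ∧ e' = 0 then coefA i c1 c2 c3 (N-j)
  else if e = 0 ∧ e' = 0 then gam00 i j c1 c2 c3 c4 N
  else 0

/-- Nine-point difference coefficients `D^{e,e'}(x,y; c1,c2,c3,c4)` (with
`c0 = −2N−3−c1−c2−c3−c4`). -/
def nineD (e e' : ℤ) (x y : ℝ) (c1 c2 c3 c4 N : ℝ) : ℝ :=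
  let c0 : ℝ := -2*N-3-c1-c2-c3-c4
  if e = 1 ∧ e' = 1 then -(Ffun x c1 c2) * Bm y c3 c0 (N-x)
  else if e = 1 ∧ e' = 0 then (Ffun x c1 c2) * SmD y c3 c0 (N-x)
  else if e = 1 ∧ e' = -1 then -(Ffun x c1 c2) * Dm y c3 c0 (N-x)
  else if e = -1 ∧ e' = 1 then -(Ffun (-x-c1-c2-1) c1 c2) * Bp y c3 c0 c4 (N-x)
  else if e = -1 ∧ e' = 0 then (Ffun (-x-c1-c2-1) c1 c2) * SpD y c3 c0 c4 (N-x)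
  else if e = -1 ∧ e' = -1 then -(Ffun (-x-c1-c2-1) c1 c2) * Dp y c3 c0 c4 (N-x)
  else if e = 0 ∧ e' = 1 then (Ffun x c1 c2 + Ffun (-x-c1-c2-1) c1 c2) * coefB y c3 c0 c4 (N-x)
  else if e = 0 ∧ e' = 0 then
    -(Ffun x c1 c2 + Ffun (-x-c1-c2-1) c1 c2) *
      (coefS y c3 c0 c4 (N-x) + (N-x)^2 + (c0+c3+c4+2)*(N-x) + (1/2)*(c3+1)*(c0+c3+c4+1))
  else if e = 0 ∧ e' = -1 then (Ffun x c1 c2 + Ffun (-x-c1-c2-1) c1 c2) * coefD y c3 c0 c4 (N-x)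
  else 0

/-- `Ψ^{a,b}(x,y)` coefficients: the first superscript refers to the shift in `y`,
the second to the shift in `x` (with `c0 = −2N−3−c1−c2−c3−c4`). -/
def psi (a b : ℤ) (x y : ℝ) (c1 c2 c3 c4 N : ℝ) : ℝ :=
  let c0 : ℝ := -2*N-3-c1-c2-c3-c4
  if a = 0 ∧ b = 1 then coefB x c4 c2 c1 (N-y)
  else if a = 0 ∧ b = -1 then coefD x c4 c2 c1 (N-y)
  else if a = 1 ∧ b = 0 then coefB y c3 c0 c1 (N-x)
  else if a = -1 ∧ b = 0 then coefD y c3 c0 c1 (N-x)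
  else if a = 0 ∧ b = 0 then gam00 x y c1 c2 c4 c3 N
  else 0

/-- Tratnik polynomial of Racah type `T_{i,j}(x,y; c1,c2,c3,c4; N)`, set to `0` outside
the triangular domains. -/
def trat (c1 c2 c3 c4 : ℝ) (Nn : ℕ) (i j x y : ℤ) : ℝ :=
  let c0 : ℝ := -2*(Nn:ℝ)-3-c1-c2-c3-c4
  if 0 ≤ i ∧ 0 ≤ j ∧ i + j ≤ (Nn:ℤ) ∧ 0 ≤ x ∧ 0 ≤ y ∧ x + y ≤ (Nn:ℤ) then
    racah i (x:ℝ) c1 c2 c3 ((Nn:ℤ)-j) * racah j (y:ℝ) c3 c0 c4 ((Nn:ℤ)-x)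
  else 0

/-- Griffiths polynomial of Racah type `G_{i,j}(x,y; c1,c2,c3,c4; N)`, set to `0` outside
the triangular domains. -/
def grif (c1 c2 c3 c4 : ℝ) (Nn : ℕ) (i j x y : ℤ) : ℝ :=
  let c0 : ℝ := -2*(Nn:ℝ)-3-c1-c2-c3-c4
  if 0 ≤ i ∧ 0 ≤ j ∧ i + j ≤ (Nn:ℤ) ∧ 0 ≤ x ∧ 0 ≤ y ∧ x + y ≤ (Nn:ℤ) then
    ∑ a ∈ Finset.range (((Nn:ℤ)-j).toNat + 1),
      (-1:ℝ)^a * racah i (a:ℝ) c1 c2 c3 ((Nn:ℤ)-j) * racah j (y:ℝ) c3 c0 c4 ((Nn:ℤ)-(a:ℤ)) *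
        racah (a:ℤ) (x:ℝ) c4 c2 c1 ((Nn:ℤ)-y)
  else 0

/-- Krawtchouk polynomial `K_n(x; p; M)`, set to `0` unless `0 ≤ n ≤ M`. -/
def kraw (n : ℤ) (x : ℝ) (p : ℝ) (M : ℤ) : ℝ :=
  if 0 ≤ n ∧ n ≤ M then
    (M.toNat.choose n.toNat : ℝ) * (p/(1-p))^n.toNat *
      ∑ k ∈ Finset.range (n.toNat + 1),
        poch (-(n:ℝ)) k * poch (-x) k / (poch (-(M:ℝ)) k * (Nat.factorial k : ℝ)) * (1/p)^k
  else 0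

lemma poch_succ (a : ℝ) (k : ℕ) : poch a (k + 1) = poch a k * (a + k) := by
  simp [poch, Finset.prod_range_succ]

lemma poch_succ' (a : ℝ) (k : ℕ) : poch a (k + 1) = a * poch (a + 1) k := by
  induction k with
  | zero => simp [poch]
  | succ k ih =>
    rw [poch_succ, ih, poch_succ]
    push_cast
    ring

lemma poch_add_one {a : ℝ} (ha : a ≠ 0) (k : ℕ) : poch (a + 1) k = poch a k * ((a + k) / a) := by
  rw [mul_div_assoc', eq_div_iff ha, ← poch_succ, poch_succ', mul_comm]

lemma poch_eq_poch_add_one_mul {a : ℝ} {k : ℕ} (ha : a + k ≠ 0) :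
    poch a k = poch (a + 1) k * (a / (a + k)) := by
  rw [mul_div_assoc', eq_div_iff ha, ← poch_succ, poch_succ', mul_comm]

lemma poch_neg_self_succ (n : ℕ) : poch (-(n : ℝ)) (n + 1) = 0 := by
  simp [poch_succ]

lemma Generic.ne_zero {r y : ℝ} (h : Generic r) (m : ℤ) (hy : y = r + m) : y ≠ 0 := fun e =>
  h (-m) (by push_cast; linarith)

/-- The normalization `Ω(n; c1,c2,c3; n+m)` for natural numbers `n` and `m`. -/
def racahNorm (c1 c2 c3 : ℝ) (n m : ℕ) : ℝ :=
  ((n + m).choose n : ℝ) * (2 * (n : ℝ) + c2 + c3 + 1) *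
    poch (c2 + 1) n * poch ((n : ℝ) + m + 2 + c1 + c2 + c3) n * poch (c1 + 1) m /
    (poch (c3 + 1) n * poch (c2 + c3 + (n : ℝ) + 1) (n + m + 1))

/-- The factor of the `k`-th summand of the Racah polynomial of degree `n` and size `n+m` which
does not depend on the variable. -/
def racahSummand (c1 c2 c3 : ℝ) (n m k : ℕ) : ℝ :=
  poch (-(n : ℝ)) k * poch ((n : ℝ) + c2 + c3 + 1) k /
    (poch (c2 + 1) k * poch ((n : ℝ) + m + 2 + c1 + c2 + c3) k * poch (-((n : ℝ) + m)) k *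
      (Nat.factorial k : ℝ))

/-- The coefficient of `(-x)_k (x+c1+c2+1)_k` in the renormalized Racah polynomial of degree `n`
and size `n+m`. -/
def racahCoeff (c1 c2 c3 : ℝ) (n m k : ℕ) : ℝ :=
  racahNorm c1 c2 c3 n m * racahSummand c1 c2 c3 n m k

/-- The basis `(-x)_k (x+c+1)_k` in which Racah polynomials are expanded. -/
def racahBasis (c x : ℝ) (k : ℕ) : ℝ := poch (-x) k * poch (x + c + 1) k

lemma racahBasis_succ (c x : ℝ) (k : ℕ) :
    racahBasis c x (k + 1) = racahBasis c x k * ((k - x) * (x + c + 1 + k)) := by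
  simp only [racahBasis, poch_succ]
  ring

lemma racah_eq_sum (c1 c2 c3 x : ℝ) (n m : ℕ) (i M : ℤ) (hi : i = n) (hM : M = n + m) :
    racah i x c1 c2 c3 M =
      ∑ k ∈ Finset.range (n + 1), racahCoeff c1 c2 c3 n m k * racahBasis (c1 + c2) x k := by
  subst hi hM
  have hnorm : Om (n : ℤ) c1 c2 c3 ((n : ℤ) + m) = racahNorm c1 c2 c3 n m := by
    have h1 : ((n : ℤ) + m).toNat = n + m := by omega
    have h2 : ((n : ℤ) + m - n).toNat = m := by omega
    simp only [Om, racahNorm, h1, h2, Int.toNat_natCast]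
    push_cast
    rfl
  rw [racah, if_pos (by omega), hnorm, Finset.mul_sum, Int.toNat_natCast]
  refine Finset.sum_congr rfl fun k _ => ?_
  simp only [racahCoeff, racahSummand, racahBasis]
  push_cast
  rw [← add_assoc x c1 c2]
  ring

/-- The ratio of consecutive coefficients in degree `n`, size `n+m`. -/
def nextRatio (c1 c2 c3 n m k : ℝ) : ℝ :=
  (-n + k) * (n + c2 + c3 + 1 + k) /
    ((c2 + 1 + k) * (n + m + 2 + c1 + c2 + c3 + k) * (-(n + m) + k) * (k + 1))

/-- The ratio of the coefficients of sizes `n+m+1` and `n+m` in degree `n`. -/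
def sizeRatio (c1 c2 c3 n m k : ℝ) : ℝ :=
  (n + m + 2 + c1 + c2 + c3 + n) * (c1 + 1 + m) * (n + m + 1 - k) /
    ((m + 1) * (c2 + c3 + n + (n + m) + 2) * (n + m + 2 + c1 + c2 + c3 + k))

/-- The ratio of the coefficients in degree `n+1`, size `n+m+1` and in degree `n`, size `n+m`. -/
def upRatio (c1 c2 c3 n m k : ℝ) : ℝ :=
  (n + m + 1 - k) * (2 * n + c2 + c3 + 3) * (c2 + 1 + n) * (n + m + 2 + c1 + c2 + c3 + n) *
      (n + m + 2 + c1 + c2 + c3 + n + 1) * (c2 + c3 + n + 1 + k) /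
    ((n + 1 - k) * (2 * n + c2 + c3 + 1) * (n + m + 2 + c1 + c2 + c3 + k) * (c3 + 1 + n) *
      (c2 + c3 + n + (n + m) + 2) * (c2 + c3 + n + (n + m) + 3))

/-- The ratio of the coefficients in degree `n-1`, size `n+m+1` and in degree `n`, size `n+m`. -/
def downRatio (c1 c2 c3 n m k : ℝ) : ℝ :=
  (n - k) * (2 * n + c2 + c3 - 1) * (c1 + 1 + m) * (c1 + 2 + m) * (c3 + n) * (n + m + 1 - k) /
    ((m + 1) * (m + 2) * (2 * n + c2 + c3 + 1) * (c2 + n) * (c2 + c3 + n + k) *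
      (n + m + 2 + c1 + c2 + c3 + k))

section Ratios

variable {c1 c2 c3 : ℝ} (n m k : ℕ)

lemma choose_size_succ : ((n + (m + 1)).choose n : ℝ) =
    (n + m).choose n * ((n : ℝ) + m + 1) / ((m : ℝ) + 1) := by
  have h := Nat.choose_mul_succ_eq (n + m) n
  rw [show n + m + 1 - n = m + 1 by omega] at h
  rw [eq_div_iff (by positivity), ← add_assoc]
  exact_mod_cast h.symm

lemma choose_up : ((n + 1 + m).choose (n + 1) : ℝ) =
    (n + m).choose n * ((n : ℝ) + m + 1) / ((n : ℝ) + 1) := by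
  have h := Nat.add_one_mul_choose_eq (n + m) n
  rw [eq_div_iff (by positivity), show n + 1 + m = n + m + 1 by omega, mul_comm _ ((n : ℝ) + m + 1)]
  exact_mod_cast h.symm

lemma choose_down : ((n + (m + 2)).choose n : ℝ) =
    (n + 1 + m).choose (n + 1) * ((n : ℝ) + 1) * ((n : ℝ) + m + 2) / (((m : ℝ) + 1) * (m + 2)) := by
  rw [show m + 2 = m + 1 + 1 by omega, choose_size_succ, choose_size_succ, choose_up]
  push_cast
  field_simp
  ring

lemma norm_ratio {w z p q r u v z' fw fp fq fr fu fv R : ℝ} (hz : z ≠ 0)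
    (hR : fw * z' * fp * fq * fr / (z * fu * fv) = R) :
    (w * fw) * z' * (p * fp) * (q * fq) * (r * fr) / ((u * fu) * (v * fv)) =
      w * z * p * q * r / (u * v) * R := by
  rw [← hR, div_mul_div_comm,
    show w * z * p * q * r * (fw * z' * fp * fq * fr) =
      z * ((w * fw) * z' * (p * fp) * (q * fq) * (r * fr)) by ring,
    show u * v * (z * fu * fv) = z * (u * fu * (v * fv)) by ring, mul_div_mul_left _ _ hz]

lemma summand_ratio {p q u v w f fp fq fu fv fw ff R : ℝ}
    (hR : fp * fq / (fu * fv * fw * ff) = R) :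
    (p * fp) * (q * fq) / ((u * fu) * (v * fv) * (w * fw) * (f * ff)) =
      p * q / (u * v * w * f) * R := by
  rw [← hR, div_mul_div_comm]
  congr 1 <;> ring

lemma racahCoeff_succ : racahCoeff c1 c2 c3 n m (k + 1) =
    racahCoeff c1 c2 c3 n m k * nextRatio c1 c2 c3 n m k := by
  rw [racahCoeff, racahCoeff, mul_assoc]
  congr 1
  simp only [racahSummand, poch_succ]
  rw [Nat.factorial_succ, Nat.cast_mul, mul_comm ((k + 1 : ℕ) : ℝ)]
  refine summand_ratio ?_
  push_cast
  rfl

lemma racahNorm_size_succ (h23 : Generic (c2 + c3)) (h123 : Generic (c1 + c2 + c3)) :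
    racahNorm c1 c2 c3 n (m + 1) = racahNorm c1 c2 c3 n m *
    (((n : ℝ) + m + 1) * (n + m + 2 + c1 + c2 + c3 + n) * (c1 + 1 + m) /
      ((m + 1) * (n + m + 2 + c1 + c2 + c3) * (c2 + c3 + n + (n + m) + 2))) := by
  have hs : (n : ℝ) + m + 2 + c1 + c2 + c3 ≠ 0 :=
    h123.ne_zero (n + m + 2) (by push_cast; ring)
  have h0 : 2 * n + c2 + c3 + 1 ≠ 0 := h23.ne_zero (2 * n + 1) (by push_cast; ring)
  have ht : c2 + c3 + n + (n + m) + 2 ≠ 0 := h23.ne_zero (n + (n + m) + 2) (by push_cast; ring)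
  have ev : poch (c2 + c3 + (n : ℝ) + 1) (n + (m + 1) + 1) =
      poch (c2 + c3 + (n : ℝ) + 1) (n + m + 1) * (c2 + c3 + n + (n + m) + 2) := by
    rw [← add_assoc n m 1, poch_succ _ (n + m + 1)]
    push_cast; ring
  have eq : poch ((n : ℝ) + (m + 1 : ℕ) + 2 + c1 + c2 + c3) n =
      poch (n + m + 2 + c1 + c2 + c3) n *
        ((n + m + 2 + c1 + c2 + c3 + n) / (n + m + 2 + c1 + c2 + c3)) := by
    rw [show (n : ℝ) + (m + 1 : ℕ) + 2 + c1 + c2 + c3 = n + m + 2 + c1 + c2 + c3 + 1 by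
      push_cast; ring]
    exact poch_add_one hs n
  rw [racahNorm, choose_size_succ, mul_div_assoc ((n + m).choose n : ℝ), eq, ev,
    poch_succ, ← mul_one (poch (c2 + 1) n), ← mul_one (poch (c3 + 1) n), norm_ratio h0 rfl,
    racahNorm]
  congr 1
  have hm : (m : ℝ) + 1 ≠ 0 := by positivity
  generalize 2 * (n : ℝ) + c2 + c3 + 1 = z at h0 ⊢
  field_simp

lemma racahNorm_up (h3 : Generic c3) (h23 : Generic (c2 + c3)) (h123 : Generic (c1 + c2 + c3)) :
    racahNorm c1 c2 c3 (n + 1) m = racahNorm c1 c2 c3 n m *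
    (((n : ℝ) + m + 1) * (2 * n + c2 + c3 + 3) * (c2 + 1 + n) * (n + m + 2 + c1 + c2 + c3 + n) *
      (n + m + 2 + c1 + c2 + c3 + n + 1) * (c2 + c3 + n + 1) /
      ((n + 1) * (2 * n + c2 + c3 + 1) * (n + m + 2 + c1 + c2 + c3) * (c3 + 1 + n) *
        (c2 + c3 + n + (n + m) + 2) * (c2 + c3 + n + (n + m) + 3))) := by
  have hs : (n : ℝ) + m + 2 + c1 + c2 + c3 ≠ 0 :=
    h123.ne_zero (n + m + 2) (by push_cast; ring)
  have h0 : 2 * n + c2 + c3 + 1 ≠ 0 := h23.ne_zero (2 * n + 1) (by push_cast; ring)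
  have ht : c2 + c3 + n + 1 ≠ 0 := h23.ne_zero (n + 1) (by push_cast; ring)
  have h30 : c3 + 1 + n ≠ 0 := h3.ne_zero (n + 1) (by push_cast; ring)
  have ht2 : c2 + c3 + n + (n + m) + 2 ≠ 0 := h23.ne_zero (n + (n + m) + 2) (by push_cast; ring)
  have ht3 : c2 + c3 + n + (n + m) + 3 ≠ 0 := h23.ne_zero (n + (n + m) + 3) (by push_cast; ring)
  have hn : (n : ℝ) + 1 ≠ 0 := by positivity
  have ev : poch (c2 + c3 + ((n + 1 : ℕ) : ℝ) + 1) (n + 1 + m + 1) =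
      poch (c2 + c3 + (n : ℝ) + 1) (n + m + 1) *
        ((c2 + c3 + n + (n + m) + 2) * (c2 + c3 + n + (n + m) + 3) / (c2 + c3 + n + 1)) := by
    rw [show c2 + c3 + ((n + 1 : ℕ) : ℝ) + 1 = c2 + c3 + n + 1 + 1 by push_cast; ring,
      poch_add_one ht, show n + 1 + m + 1 = n + m + 1 + 1 by ring, poch_succ _ (n + m + 1)]
    push_cast; ring
  have eq : poch (((n + 1 : ℕ) : ℝ) + m + 2 + c1 + c2 + c3) (n + 1) =
      poch (n + m + 2 + c1 + c2 + c3) n * ((n + m + 2 + c1 + c2 + c3 + n) *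
        (n + m + 2 + c1 + c2 + c3 + n + 1) / (n + m + 2 + c1 + c2 + c3)) := by
    rw [show ((n + 1 : ℕ) : ℝ) + m + 2 + c1 + c2 + c3 = n + m + 2 + c1 + c2 + c3 + 1 by
      push_cast; ring, poch_add_one hs, poch_succ]
    push_cast; ring
  have ez : 2 * ((n + 1 : ℕ) : ℝ) + c2 + c3 + 1 = 2 * n + c2 + c3 + 3 := by push_cast; ring
  rw [racahNorm, choose_up, mul_div_assoc ((n + m).choose n : ℝ), eq, ev,
    poch_succ, poch_succ, ez, ← mul_one (poch (c1 + 1) m), norm_ratio h0 rfl, mul_one, racahNorm]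
  congr 1
  field_simp

lemma racahNorm_down (h2 : Generic c2) (h3 : Generic c3)
    (h23 : Generic (c2 + c3)) (h123 : Generic (c1 + c2 + c3)) :
    racahNorm c1 c2 c3 n (m + 2) = racahNorm c1 c2 c3 (n + 1) m *
    (((n : ℝ) + 1) * (n + m + 2) * (2 * n + c2 + c3 + 1) * (c1 + 1 + m) * (c1 + 2 + m) *
      (c3 + 1 + n) /
      ((m + 1) * (m + 2) * (2 * n + c2 + c3 + 3) * (c2 + 1 + n) * (n + m + 3 + c1 + c2 + c3) *
        (c2 + c3 + n + 1))) := by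
  have hs : (n : ℝ) + m + 3 + c1 + c2 + c3 ≠ 0 :=
    h123.ne_zero (n + m + 3) (by push_cast; ring)
  have h0 : 2 * ((n + 1 : ℕ) : ℝ) + c2 + c3 + 1 ≠ 0 :=
    h23.ne_zero (2 * n + 3) (by push_cast; ring)
  have ht : c2 + c3 + n + 1 ≠ 0 := h23.ne_zero (n + 1) (by push_cast; ring)
  have h20 : c2 + 1 + n ≠ 0 := h2.ne_zero (n + 1) (by push_cast; ring)
  have h30 : c3 + 1 + n ≠ 0 := h3.ne_zero (n + 1) (by push_cast; ring)
  have ep : poch (c2 + 1) n = poch (c2 + 1) (n + 1) * (1 / (c2 + 1 + n)) := by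
    rw [poch_succ, mul_one_div, mul_div_cancel_right₀ _ h20]
  have eu : poch (c3 + 1) n = poch (c3 + 1) (n + 1) * (1 / (c3 + 1 + n)) := by
    rw [poch_succ, mul_one_div, mul_div_cancel_right₀ _ h30]
  have er : poch (c1 + 1) (m + 2) = poch (c1 + 1) m * ((c1 + 1 + m) * (c1 + 2 + m)) := by
    rw [poch_succ, poch_succ]
    push_cast; ring
  have ev : poch (c2 + c3 + n + 1) (n + (m + 2) + 1) =
      poch (c2 + c3 + ((n + 1 : ℕ) : ℝ) + 1) (n + 1 + m + 1) * (c2 + c3 + n + 1) := by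
    rw [show c2 + c3 + ((n + 1 : ℕ) : ℝ) + 1 = c2 + c3 + n + 1 + 1 by push_cast; ring,
      poch_succ', show n + (m + 2) = n + 1 + m + 1 by ring, mul_comm]
  have eq : poch (n + ((m + 2 : ℕ) : ℝ) + 2 + c1 + c2 + c3) n =
      poch (((n + 1 : ℕ) : ℝ) + m + 2 + c1 + c2 + c3) (n + 1) *
        (1 / (n + m + 3 + c1 + c2 + c3)) := by
    rw [show ((n + 1 : ℕ) : ℝ) + m + 2 + c1 + c2 + c3 = n + m + 3 + c1 + c2 + c3 by
      push_cast; ring, poch_succ', mul_one_div, mul_div_cancel_left₀ _ hs,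
      show (n : ℝ) + ((m + 2 : ℕ) : ℝ) + 2 + c1 + c2 + c3 = n + m + 3 + c1 + c2 + c3 + 1 by
      push_cast; ring]
  rw [racahNorm, racahNorm, choose_down, mul_assoc ((n + 1 + m).choose (n + 1) : ℝ),
    mul_div_assoc ((n + 1 + m).choose (n + 1) : ℝ), ep, eq, er, eu, ev]
  rw [norm_ratio h0 rfl]
  congr 1
  have ez : 2 * ((n + 1 : ℕ) : ℝ) + c2 + c3 + 1 = 2 * n + c2 + c3 + 3 := by push_cast; ring
  rw [ez] at h0 ⊢
  have hm : (m : ℝ) + 1 ≠ 0 := by positivity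
  have hm2 : (m : ℝ) + 2 ≠ 0 := by positivity
  field_simp

variable {n k}

lemma racahSummand_size_succ (h123 : Generic (c1 + c2 + c3))
    (hk : k ≤ n) :
    racahSummand c1 c2 c3 n (m + 1) k = racahSummand c1 c2 c3 n m k *
      ((n + m + 2 + c1 + c2 + c3) * (n + m + 1 - k) /
        ((n + m + 2 + c1 + c2 + c3 + k) * (n + m + 1))) := by
  have hs : (n : ℝ) + m + 2 + c1 + c2 + c3 ≠ 0 :=
    h123.ne_zero (n + m + 2) (by push_cast; ring)
  have hsk : (n : ℝ) + m + 2 + c1 + c2 + c3 + k ≠ 0 :=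
    h123.ne_zero (n + m + 2 + k) (by push_cast; ring)
  have hk' : (k : ℝ) ≤ n := by exact_mod_cast hk
  have hM : (n : ℝ) + m + 1 - k ≠ 0 := by have : (0 : ℝ) ≤ m := m.cast_nonneg; linarith
  have hM0 : (n : ℝ) + m + 1 ≠ 0 := by positivity
  have ev : poch ((n : ℝ) + (m + 1 : ℕ) + 2 + c1 + c2 + c3) k =
      poch (n + m + 2 + c1 + c2 + c3) k *
        ((n + m + 2 + c1 + c2 + c3 + k) / (n + m + 2 + c1 + c2 + c3)) := by
    rw [show (n : ℝ) + (m + 1 : ℕ) + 2 + c1 + c2 + c3 = n + m + 2 + c1 + c2 + c3 + 1 by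
      push_cast; ring]
    exact poch_add_one hs k
  have ew : poch (-((n : ℝ) + (m + 1 : ℕ))) k =
      poch (-((n : ℝ) + m)) k * ((n + m + 1) / (n + m + 1 - k)) := by
    have e : -((n : ℝ) + (m + 1 : ℕ)) + k = -(n + m + 1 - k) := by push_cast; ring
    rw [poch_eq_poch_add_one_mul (by rw [e]; exact neg_ne_zero.2 hM), e]
    congr 1
    · congr 1; push_cast; ring
    · rw [div_neg, ← neg_div]; push_cast; ring
  rw [racahSummand, ev, ew, ← mul_one (poch (-(n : ℝ)) k), ← mul_one (poch (n + c2 + c3 + 1) k),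
    ← mul_one (poch (c2 + 1) k), ← mul_one (k.factorial : ℝ), summand_ratio rfl, racahSummand]
  congr 1
  field_simp

lemma racahSummand_up (h23 : Generic (c2 + c3))
    (hk : k ≤ n) :
    racahSummand c1 c2 c3 (n + 1) m k = racahSummand c1 c2 c3 n (m + 1) k *
      ((n + 1) * (n + c2 + c3 + 1 + k) / ((n + 1 - k) * (n + c2 + c3 + 1))) := by
  have hk' : (k : ℝ) ≤ n := by exact_mod_cast hk
  have hM : (n : ℝ) + 1 - k ≠ 0 := by linarith
  have ht : (n : ℝ) + c2 + c3 + 1 ≠ 0 := h23.ne_zero (n + 1) (by push_cast; ring)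
  have ep : poch (-((n + 1 : ℕ) : ℝ)) k = poch (-(n : ℝ)) k * ((n + 1) / (n + 1 - k)) := by
    have e : -((n + 1 : ℕ) : ℝ) + k = -(n + 1 - k) := by push_cast; ring
    rw [poch_eq_poch_add_one_mul (by rw [e]; exact neg_ne_zero.2 hM), e]
    congr 1
    · congr 1; push_cast; ring
    · rw [div_neg, ← neg_div]; push_cast; ring
  have eq : poch (((n + 1 : ℕ) : ℝ) + c2 + c3 + 1) k =
      poch (n + c2 + c3 + 1) k * ((n + c2 + c3 + 1 + k) / (n + c2 + c3 + 1)) := by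
    rw [show ((n + 1 : ℕ) : ℝ) + c2 + c3 + 1 = n + c2 + c3 + 1 + 1 by push_cast; ring]
    exact poch_add_one ht k
  have e : ((n + 1 : ℕ) : ℝ) + m = n + (m + 1 : ℕ) := by push_cast; ring
  rw [racahSummand, ep, eq, e, racahSummand]
  simp only [div_eq_mul_inv, mul_inv]
  ring

lemma racahCoeff_size_succ (h23 : Generic (c2 + c3)) (h123 : Generic (c1 + c2 + c3))
    (hk : k ≤ n) :
    racahCoeff c1 c2 c3 n (m + 1) k =
      racahCoeff c1 c2 c3 n m k * sizeRatio c1 c2 c3 n m k := by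
  have hs : (n : ℝ) + m + 2 + c1 + c2 + c3 ≠ 0 :=
    h123.ne_zero (n + m + 2) (by push_cast; ring)
  have hM0 : (n : ℝ) + m + 1 ≠ 0 := by positivity
  rw [racahCoeff, racahCoeff, racahNorm_size_succ n m h23 h123, racahSummand_size_succ m h123 hk,
    mul_mul_mul_comm, sizeRatio]
  congr 1
  field_simp

lemma racahCoeff_up (h3 : Generic c3) (h23 : Generic (c2 + c3)) (h123 : Generic (c1 + c2 + c3))
    (hk : k ≤ n) :
    racahCoeff c1 c2 c3 (n + 1) m k =
      racahCoeff c1 c2 c3 n m k * upRatio c1 c2 c3 n m k := by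
  have hs : (n : ℝ) + m + 2 + c1 + c2 + c3 ≠ 0 :=
    h123.ne_zero (n + m + 2) (by push_cast; ring)
  have ht : c2 + c3 + n + 1 ≠ 0 := h23.ne_zero (n + 1) (by push_cast; ring)
  have hk' : (k : ℝ) ≤ n := by exact_mod_cast hk
  have hM : (n : ℝ) + 1 - k ≠ 0 := by linarith
  have hsk : (n : ℝ) + m + 2 + c1 + c2 + c3 + k ≠ 0 :=
    h123.ne_zero (n + m + 2 + k) (by push_cast; ring)
  have h0 : 2 * n + c2 + c3 + 1 ≠ 0 := h23.ne_zero (2 * n + 1) (by push_cast; ring)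
  have h30 : c3 + 1 + n ≠ 0 := h3.ne_zero (n + 1) (by push_cast; ring)
  have ht2 : c2 + c3 + n + (n + m) + 2 ≠ 0 := h23.ne_zero (n + (n + m) + 2) (by push_cast; ring)
  have ht3 : c2 + c3 + n + (n + m) + 3 ≠ 0 := h23.ne_zero (n + (n + m) + 3) (by push_cast; ring)
  have hM0 : (n : ℝ) + m + 1 ≠ 0 := by positivity
  have hn : (n : ℝ) + 1 ≠ 0 := by positivity
  rw [racahCoeff, racahCoeff, racahNorm_up n m h3 h23 h123, racahSummand_up m h23 hk,
    racahSummand_size_succ m h123 hk, mul_assoc (racahSummand _ _ _ _ _ _),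
    mul_mul_mul_comm, upRatio, show (n : ℝ) + c2 + c3 + 1 + k = c2 + c3 + n + 1 + k by ring,
    show (n : ℝ) + c2 + c3 + 1 = c2 + c3 + n + 1 by ring]
  congr 1
  generalize (n : ℝ) + m + 2 + c1 + c2 + c3 = s at hs hsk ⊢
  generalize c2 + c3 + (n : ℝ) + 1 = t at ht ⊢
  generalize (n : ℝ) + m + 1 = M at hM0 ⊢
  generalize c2 + c3 + (n : ℝ) + (n + m) + 2 = t2 at ht2 ⊢
  generalize c2 + c3 + (n : ℝ) + (n + m) + 3 = t3 at ht3 ⊢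
  generalize 2 * (n : ℝ) + c2 + c3 + 1 = z at h0 ⊢
  field_simp

lemma racahCoeff_down (h2 : Generic c2) (h3 : Generic c3)
    (h23 : Generic (c2 + c3)) (h123 : Generic (c1 + c2 + c3))
    (hk : k ≤ n + 1) :
    racahCoeff c1 c2 c3 n (m + 2) k =
      racahCoeff c1 c2 c3 (n + 1) m k * downRatio c1 c2 c3 (n + 1) m k := by
  rcases hk.eq_or_lt with rfl | hk
  · have : racahSummand c1 c2 c3 n (m + 2) (n + 1) = 0 := by
      rw [racahSummand, poch_neg_self_succ, zero_mul, zero_div]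
    rw [racahCoeff, this, downRatio]
    push_cast
    ring
  have hk := Nat.lt_succ_iff.1 hk
  have hk' : (k : ℝ) ≤ n := by exact_mod_cast hk
  have hM : (n : ℝ) + 1 - k ≠ 0 := by linarith
  have hs : (n : ℝ) + m + 3 + c1 + c2 + c3 ≠ 0 :=
    h123.ne_zero (n + m + 3) (by push_cast; ring)
  have ht : c2 + c3 + n + 1 ≠ 0 := h23.ne_zero (n + 1) (by push_cast; ring)
  have htk : c2 + c3 + n + 1 + k ≠ 0 := h23.ne_zero (n + 1 + k) (by push_cast; ring)
  have hn : (n : ℝ) + 1 ≠ 0 := by positivity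
  have hM0 : (n : ℝ) + m + 2 ≠ 0 := by positivity
  have key := racahSummand_size_succ (m + 1) h123 hk
  have hup := racahSummand_up (c1 := c1) m h23 hk
  rw [show (n : ℝ) + c2 + c3 + 1 + k = c2 + c3 + n + 1 + k by ring,
    show (n : ℝ) + c2 + c3 + 1 = c2 + c3 + n + 1 by ring,
    ← div_eq_iff (by positivity)] at hup
  rw [racahCoeff, racahCoeff, racahNorm_down n m h2 h3 h23 h123,
    show m + 2 = m + 1 + 1 from rfl, key, ← hup, div_eq_mul_inv (racahSummand _ _ _ _ _ _),
    mul_assoc (racahSummand _ _ _ _ _ _), mul_mul_mul_comm, downRatio]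
  congr 1
  rw [show (n : ℝ) + ((m + 1 : ℕ) : ℝ) + 2 + c1 + c2 + c3 = n + m + 3 + c1 + c2 + c3 by
      push_cast; ring, show (n : ℝ) + ((m + 1 : ℕ) : ℝ) + 1 = n + m + 2 by push_cast; ring,
    show (n : ℝ) + 1 + m + 2 + c1 + c2 + c3 = n + m + 3 + c1 + c2 + c3 by ring,
    show 2 * ((n : ℝ) + 1) + c2 + c3 + 1 = 2 * n + c2 + c3 + 3 by ring,
    show c2 + c3 + ((n : ℝ) + 1) + k = c2 + c3 + n + 1 + k by ring,
    show c2 + ((n : ℝ) + 1) = c2 + 1 + n by ring]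
  field_simp
  ring

end Ratios

lemma Cp_mul_upRatio {c1 c2 c3 n m k : ℝ} (h3 : 2 * n + c2 + c3 + 3 ≠ 0)
    (hc : c3 + 1 + n ≠ 0) (ht2 : c2 + c3 + n + (n + m) + 2 ≠ 0)
    (ht3 : c2 + c3 + n + (n + m) + 3 ≠ 0) :
    Cp (n + 1) c2 c3 (n + m) * upRatio c1 c2 c3 n m k =
      -((n + m + 1 - k) * (c2 + 1 + n) * (n + 1) * (n + m + 2 + c1 + c2 + c3 + n) *
          (n + m + 2 + c1 + c2 + c3 + n + 1) * (c2 + c3 + n + 1 + k)) /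
        ((n + 1 - k) * (2 * n + c2 + c3 + 1) * (2 * n + c2 + c3 + 2) *
          (n + m + 2 + c1 + c2 + c3 + k)) := by
  have e : Cp (n + 1) c2 c3 (n + m) =
      -((c2 + c3 + n + (n + m) + 2) * (c2 + c3 + n + (n + m) + 3) * (c3 + 1 + n) * (n + 1)) /
        ((2 * n + c2 + c3 + 3) * (2 * n + c2 + c3 + 2)) := by
    have e1 : (2 * (-(n + 1) - c2 - c3 - 1) + c3 + c2 + 1) *
        (2 * (-(n + 1) - c2 - c3 - 1) + c3 + c2 + 2) =
        (2 * n + c2 + c3 + 3) * (2 * n + c2 + c3 + 2) := by ring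
    rw [Cp, Ap, Ffun, e1, mul_div_assoc']
    congr 1
    ring
  rw [e, upRatio, div_mul_div_comm]
  rw [show -((c2 + c3 + n + (n + m) + 2) * (c2 + c3 + n + (n + m) + 3) * (c3 + 1 + n) * (n + 1)) *
    ((n + m + 1 - k) * (2 * n + c2 + c3 + 3) * (c2 + 1 + n) * (n + m + 2 + c1 + c2 + c3 + n) *
      (n + m + 2 + c1 + c2 + c3 + n + 1) * (c2 + c3 + n + 1 + k)) =
    ((c2 + c3 + n + (n + m) + 2) * (c2 + c3 + n + (n + m) + 3) * (c3 + 1 + n) *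
      (2 * n + c2 + c3 + 3)) * -((n + m + 1 - k) * (c2 + 1 + n) * (n + 1) *
        (n + m + 2 + c1 + c2 + c3 + n) *
          (n + m + 2 + c1 + c2 + c3 + n + 1) * (c2 + c3 + n + 1 + k)) by
      generalize c2 + c3 + n + (n + m) + 2 = x1, c2 + c3 + n + (n + m) + 3 = x2,
        2 * n + c2 + c3 + 3 = x3, n + m + 2 + c1 + c2 + c3 + n + 1 = x4,
        n + m + 2 + c1 + c2 + c3 + n = x5, c2 + c3 + n + 1 + k = x6
      ring,
    show (2 * n + c2 + c3 + 3) * (2 * n + c2 + c3 + 2) * ((n + 1 - k) * (2 * n + c2 + c3 + 1) *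
      (n + m + 2 + c1 + c2 + c3 + k) * (c3 + 1 + n) *
      (c2 + c3 + n + (n + m) + 2) * (c2 + c3 + n + (n + m) + 3)) =
      ((c2 + c3 + n + (n + m) + 2) * (c2 + c3 + n + (n + m) + 3) * (c3 + 1 + n) *
      (2 * n + c2 + c3 + 3)) * ((n + 1 - k) * (2 * n + c2 + c3 + 1) * (2 * n + c2 + c3 + 2) *
          (n + m + 2 + c1 + c2 + c3 + k)) by
      generalize c2 + c3 + n + (n + m) + 2 = x1, c2 + c3 + n + (n + m) + 3 = x2,
        2 * n + c2 + c3 + 3 = x3, 2 * n + c2 + c3 + 2 = x4, 2 * n + c2 + c3 + 1 = x5,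
        n + m + 2 + c1 + c2 + c3 + k = x6
      ring, mul_div_mul_left]
  exact mul_ne_zero (mul_ne_zero (mul_ne_zero ht2 ht3) hc) h3

lemma Ap_mul_downRatio {c1 c2 c3 n m k : ℝ} (h : 2 * n + c2 + c3 - 1 ≠ 0) (hm : m + 1 ≠ 0)
    (hm2 : m + 2 ≠ 0) (hc : c2 + n ≠ 0) :
    Ap (n - 1) c2 c3 (n + m) * downRatio c1 c2 c3 n m k =
      -((n - k) * (c2 + c3 + n) * (c1 + 1 + m) * (c1 + 2 + m) * (c3 + n) * (n + m + 1 - k)) /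
        ((2 * n + c2 + c3) * (2 * n + c2 + c3 + 1) * (c2 + c3 + n + k) *
          (n + m + 2 + c1 + c2 + c3 + k)) := by
  have e : Ap (n - 1) c2 c3 (n + m) =
      -((m + 1) * (m + 2) * (c2 + n) * (c2 + c3 + n)) /
        ((2 * n + c2 + c3 - 1) * (2 * n + c2 + c3)) := by
    have e1 : (2 * (n - 1) + c3 + c2 + 1) * (2 * (n - 1) + c3 + c2 + 2) =
        (2 * n + c2 + c3 - 1) * (2 * n + c2 + c3) := by ring
    rw [Ap, Ffun, e1, mul_div_assoc']
    congr 1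
    ring
  rw [e, downRatio, div_mul_div_comm]
  rw [eq_comm, ← mul_div_mul_left _ _ (mul_ne_zero (mul_ne_zero (mul_ne_zero hm hm2) hc) h)]
  generalize 2 * n + c2 + c3 - 1 = x1, 2 * n + c2 + c3 = x2, c2 + c3 + n + k = x3,
    n + m + 2 + c1 + c2 + c3 + k = x4
  congr 1 <;> ring

lemma Sp_eq {c2 c3 n m : ℝ} :
    Sp n c2 c3 (n + m) =
      -(m * (m + 1) * (c2 + 1 + n) * (c2 + c3 + n + 1)) /
        ((2 * n + c2 + c3 + 1) * (2 * n + c2 + c3 + 2)) +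
      -(n * (c3 + n) * (c2 + c3 + n + (n + m) + 2) * (c2 + c3 + n + (n + m) + 1)) /
        ((2 * n + c2 + c3) * (2 * n + c2 + c3 + 1)) + (n + m + 1) * (n + m + 1 + c3) := by
  have e1 : (2 * n + c3 + c2 + 1) * (2 * n + c3 + c2 + 2) =
      (2 * n + c2 + c3 + 1) * (2 * n + c2 + c3 + 2) := by ring
  have e2 : (2 * (-n - c2 - c3 - 1) + c3 + c2 + 1) * (2 * (-n - c2 - c3 - 1) + c3 + c2 + 2) =
      (2 * n + c2 + c3) * (2 * n + c2 + c3 + 1) := by ring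
  have e3 : -(n - (n + m) - 1) * (n - (n + m)) * ((n + c2 + 1) * (n + c3 + c2 + 1)) =
      -(m * (m + 1) * (c2 + 1 + n) * (c2 + c3 + n + 1)) := by ring
  have e4 : -(-n - c2 - c3 - 1 - (n + m) - 1) * (-n - c2 - c3 - 1 - (n + m)) *
      ((-n - c2 - c3 - 1 + c2 + 1) * (-n - c2 - c3 - 1 + c3 + c2 + 1)) =
      -(n * (c3 + n) * (c2 + c3 + n + (n + m) + 2) * (c2 + c3 + n + (n + m) + 1)) := by ring
  rw [Sp, Cp, Ap, Ap, Ffun, Ffun, e1, e2, mul_div_assoc', mul_div_assoc', e3, e4]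

/-- The relation between the coefficients of the contiguity recurrence, with all Racah
coefficients expressed through a single one. -/
lemma contiguity_coeff {c1 c2 c3 n m k : ℝ} (ha : 2 * n + c2 + c3 - 1 ≠ 0)
    (h0 : 2 * n + c2 + c3 ≠ 0) (h1 : 2 * n + c2 + c3 + 1 ≠ 0) (h2 : 2 * n + c2 + c3 + 2 ≠ 0)
    (h3 : 2 * n + c2 + c3 + 3 ≠ 0) (hc3 : c3 + 1 + n ≠ 0) (hc2 : c2 + n ≠ 0)
    (ht2 : c2 + c3 + n + (n + m) + 2 ≠ 0) (ht3 : c2 + c3 + n + (n + m) + 3 ≠ 0)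
    (hm : m + 1 ≠ 0) (hm2 : m + 2 ≠ 0) (hk : n + 1 - k ≠ 0) (hak : c2 + c3 + n + k ≠ 0)
    (hs : n + m + 2 + c1 + c2 + c3 + k ≠ 0) :
    Cp (n + 1) c2 c3 (n + m) * upRatio c1 c2 c3 n m k
        - Sp n c2 c3 (n + m) * sizeRatio c1 c2 c3 n m k
        + Ap (n - 1) c2 c3 (n + m) * downRatio c1 c2 c3 n m k =
      (k - (n + m) - 1) * (k + (n + m) + 2 + c1 + c2) -
        (c2 + k) * (n + m + 1 + c1 + c2 + c3 + k) * (n + m + 1 - k) * k /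
          ((n + 1 - k) * (c2 + c3 + n + k)) := by
  rw [Cp_mul_upRatio h3 hc3 ht2 ht3, Ap_mul_downRatio ha hm hm2 hc2, Sp_eq, sizeRatio]
  obtain ⟨p, rfl⟩ : ∃ p, k = n + 1 - p := ⟨n + 1 - k, by ring⟩
  obtain ⟨z, rfl⟩ : ∃ z, c2 = z - 2 * n - c3 := ⟨2 * n + c2 + c3, by ring⟩
  obtain ⟨s, rfl⟩ : ∃ s, c1 = s - m - 3 - z + p := ⟨c1 + m + 3 + z - p, by ring⟩
  simp only [show 2 * n + (z - 2 * n - c3) + c3 = z by ring,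
    show z - 2 * n - c3 + c3 + n = z - n by ring,
    show z - n + (n + m) = z + m by ring, show z - n + (n + 1 - p) = z + 1 - p by ring,
    show n + 1 - (n + 1 - p) = p by ring,
    show n + m + 2 + (s - m - 3 - z + p) + (z - 2 * n - c3) + c3 + (n + 1 - p) = s by ring]
    at h0 h1 h2 ht2 hk hak hs ⊢
  clear ha h3 hc3 hc2 ht3 hm2
  field_simp
  ring

lemma racah_pred_eq_sum {c1 c2 c3 : ℝ} (x : ℝ) (n m : ℕ) (h2 : Generic c2) (h3 : Generic c3)
    (h23 : Generic (c2 + c3)) (h123 : Generic (c1 + c2 + c3)) :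
    racah ((n : ℤ) - 1) x c1 c2 c3 ((n : ℤ) + m + 1) =
      ∑ k ∈ Finset.range (n + 1), racahCoeff c1 c2 c3 n m k * downRatio c1 c2 c3 n m k *
        racahBasis (c1 + c2) x k := by
  rcases n with _ | n
  · rw [racah, if_neg (by simp), Finset.sum_range_one]
    simp [downRatio]
  · rw [racah_eq_sum c1 c2 c3 x n (m + 2) _ _ (by simp) (by push_cast; ring),
      Finset.sum_range_succ _ (n + 1)]
    have hlast : downRatio c1 c2 c3 ((n + 1 : ℕ) : ℝ) m ((n + 1 : ℕ) : ℝ) = 0 := by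
      simp [downRatio]
    rw [hlast, mul_zero, zero_mul, add_zero]
    refine Finset.sum_congr rfl fun k hk => ?_
    rw [racahCoeff_down m h2 h3 h23 h123 (Finset.mem_range.1 hk).le]
    push_cast
    rfl

/-- Summation of the contiguity relation between coefficients up to an index `K ≤ n`. -/
lemma sum_contiguity {c1 c2 c3 : ℝ} (x : ℝ) (n m K : ℕ) (h2 : Generic c2) (h3 : Generic c3)
    (h23 : Generic (c2 + c3)) (h123 : Generic (c1 + c2 + c3)) (hK : K ≤ n) :
    ∑ k ∈ Finset.range (K + 1), racahCoeff c1 c2 c3 n m k *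
        (Cp ((n : ℝ) + 1) c2 c3 (n + m) * upRatio c1 c2 c3 n m k
          - Sp n c2 c3 (n + m) * sizeRatio c1 c2 c3 n m k
          + Ap ((n : ℝ) - 1) c2 c3 (n + m) * downRatio c1 c2 c3 n m k) *
        racahBasis (c1 + c2) x k =
      lamP x (c1 + c2) (n + m) *
        ∑ k ∈ Finset.range (K + 1), racahCoeff c1 c2 c3 n m k * racahBasis (c1 + c2) x k +
      racahCoeff c1 c2 c3 n m K * racahBasis (c1 + c2) x (K + 1) := by
  have hterm : ∀ k : ℕ, k ≤ n → Cp ((n : ℝ) + 1) c2 c3 (n + m) * upRatio c1 c2 c3 n m k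
          - Sp n c2 c3 (n + m) * sizeRatio c1 c2 c3 n m k
          + Ap ((n : ℝ) - 1) c2 c3 (n + m) * downRatio c1 c2 c3 n m k =
      (k - (n + m) - 1) * (k + (n + m) + 2 + c1 + c2) -
        (c2 + k) * (n + m + 1 + c1 + c2 + c3 + k) * (n + m + 1 - k) * k /
          ((n + 1 - k) * (c2 + c3 + n + k)) := fun k hk => by
    have hk' : (k : ℝ) ≤ n := by exact_mod_cast hk
    apply contiguity_coeff
    · exact h23.ne_zero (2 * n - 1) (by push_cast; ring)
    · exact h23.ne_zero (2 * n) (by push_cast; ring)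
    · exact h23.ne_zero (2 * n + 1) (by push_cast; ring)
    · exact h23.ne_zero (2 * n + 2) (by push_cast; ring)
    · exact h23.ne_zero (2 * n + 3) (by push_cast; ring)
    · exact h3.ne_zero (1 + n) (by push_cast; ring)
    · exact h2.ne_zero n (by push_cast; ring)
    · exact h23.ne_zero (n + (n + m) + 2) (by push_cast; ring)
    · exact h23.ne_zero (n + (n + m) + 3) (by push_cast; ring)
    · positivity
    · positivity
    · linarith
    · exact h23.ne_zero (n + k) (by push_cast; ring)
    · exact h123.ne_zero (n + m + 2 + k) (by push_cast; ring)
  induction K with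
  | zero =>
    rw [Finset.sum_range_one, Finset.sum_range_one, hterm 0 hK, racahBasis_succ, lamP]
    push_cast
    ring
  | succ K ih =>
    have hK' : (K : ℝ) + 1 ≤ n := by exact_mod_cast hK
    have hm : (0 : ℝ) ≤ m := m.cast_nonneg
    have hprev : racahCoeff c1 c2 c3 n m (K + 1) *
        ((c2 + (K + 1 : ℕ)) * (n + m + 1 + c1 + c2 + c3 + (K + 1 : ℕ)) *
          (n + m + 1 - (K + 1 : ℕ)) * (K + 1 : ℕ) /
          ((n + 1 - (K + 1 : ℕ)) * (c2 + c3 + n + (K + 1 : ℕ)))) = racahCoeff c1 c2 c3 n m K := by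
      have e1 : c2 + 1 + K ≠ 0 := h2.ne_zero (1 + K) (by push_cast; ring)
      have e2 : (n : ℝ) + m + 2 + c1 + c2 + c3 + K ≠ 0 :=
        h123.ne_zero (n + m + 2 + K) (by push_cast; ring)
      have e3 : (n : ℝ) + m - K ≠ 0 := by linarith
      have e4 : (K : ℝ) + 1 ≠ 0 := by positivity
      have e5 : (n : ℝ) - K ≠ 0 := by linarith
      have e6 : n + c2 + c3 + 1 + K ≠ 0 := h23.ne_zero (n + 1 + K) (by push_cast; ring)
      rw [racahCoeff_succ, mul_assoc, nextRatio]
      refine mul_right_eq_self₀.2 (Or.inl ?_)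
      push_cast
      rw [show c2 + ((K : ℝ) + 1) = c2 + 1 + K by ring,
        show (n : ℝ) + m + 1 + c1 + c2 + c3 + (K + 1) = n + m + 2 + c1 + c2 + c3 + K by ring,
        show (n : ℝ) + m + 1 - (K + 1) = n + m - K by ring,
        show (n : ℝ) + 1 - (K + 1) = n - K by ring,
        show c2 + c3 + (n : ℝ) + (K + 1) = n + c2 + c3 + 1 + K by ring,
        show -(n : ℝ) + K = -(n - K) by ring, show -((n : ℝ) + m) + K = -(n + m - K) by ring]
      generalize (n : ℝ) + m + 2 + c1 + c2 + c3 + K = y2 at e2 ⊢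
      generalize (n : ℝ) + m - K = y3 at e3 ⊢
      generalize (n : ℝ) - K = y5 at e5 ⊢
      generalize (n : ℝ) + c2 + c3 + 1 + K = y6 at e6 ⊢
      field_simp
    rw [Finset.sum_range_succ, ih (by omega), Finset.sum_range_succ _ (K + 1), hterm (K + 1) hK,
      mul_sub, hprev, racahBasis_succ _ _ (K + 1), lamP]
    push_cast
    ring

/-- contiguity recurrence relation (`N → N+1`) for the renormalized
Racah polynomials. -/
theorem racah_contiguity_recurrence_plus
    (c1 c2 c3 : ℝ) (hgen : Generic3 c1 c2 c3)
    (N n x : ℤ) (hN : 0 ≤ N) (hn0 : 0 ≤ n) (hnN : n ≤ N) (hx0 : 0 ≤ x) (hxN : x ≤ N) :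
    lamP (x:ℝ) (c1+c2) (N:ℝ) * racah n (x:ℝ) c1 c2 c3 N =
      Cp ((n:ℝ)+1) c2 c3 (N:ℝ) * racah (n+1) (x:ℝ) c1 c2 c3 (N+1)
        - Sp (n:ℝ) c2 c3 (N:ℝ) * racah n (x:ℝ) c1 c2 c3 (N+1)
        + Ap ((n:ℝ)-1) c2 c3 (N:ℝ) * racah (n-1) (x:ℝ) c1 c2 c3 (N+1) := by
  obtain ⟨-, h2, h3, -, -, h23, h123⟩ := hgen
  obtain ⟨n, rfl⟩ := Int.eq_ofNat_of_zero_le hn0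
  obtain ⟨m, rfl⟩ := Int.le.dest hnN
  have hsum := sum_contiguity (x : ℝ) n m n h2 h3 h23 h123 le_rfl
  have hsize : racah n (x : ℝ) c1 c2 c3 ((n : ℤ) + m + 1) =
      ∑ k ∈ Finset.range (n + 1), racahCoeff c1 c2 c3 n m k * sizeRatio c1 c2 c3 n m k *
        racahBasis (c1 + c2) x k := by
    rw [racah_eq_sum c1 c2 c3 x n (m + 1) _ _ rfl (by push_cast; ring)]
    refine Finset.sum_congr rfl fun k hk => ?_
    rw [racahCoeff_size_succ m h23 h123 (Nat.lt_succ_iff.1 (Finset.mem_range.1 hk))]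
  have hup : racah ((n : ℤ) + 1) (x : ℝ) c1 c2 c3 ((n : ℤ) + m + 1) =
      ∑ k ∈ Finset.range (n + 1), racahCoeff c1 c2 c3 n m k * upRatio c1 c2 c3 n m k *
        racahBasis (c1 + c2) x k +
      racahCoeff c1 c2 c3 n m n * (upRatio c1 c2 c3 n m n *
        nextRatio c1 c2 c3 (n + 1) m n) * racahBasis (c1 + c2) x (n + 1) := by
    rw [racah_eq_sum c1 c2 c3 x (n + 1) m _ _ (by simp) (by push_cast; ring),
      Finset.sum_range_succ, racahCoeff_succ, racahCoeff_up m h3 h23 h123 le_rfl]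
    congr 1
    · refine Finset.sum_congr rfl fun k hk => ?_
      rw [racahCoeff_up m h3 h23 h123 (Nat.lt_succ_iff.1 (Finset.mem_range.1 hk))]
    · push_cast
      ring
  have htop : Cp ((n : ℝ) + 1) c2 c3 (n + m) *
      (upRatio c1 c2 c3 n m n * nextRatio c1 c2 c3 (n + 1) m n) = -1 := by
    have e1 : 2 * n + c2 + c3 + 1 ≠ 0 := h23.ne_zero (2 * n + 1) (by push_cast; ring)
    have e2 : 2 * n + c2 + c3 + 2 ≠ 0 := h23.ne_zero (2 * n + 2) (by push_cast; ring)
    have e3 : (n : ℝ) + m + 2 + c1 + c2 + c3 + n ≠ 0 :=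
      h123.ne_zero (n + m + 2 + n) (by push_cast; ring)
    have e4 : (n : ℝ) + m + 2 + c1 + c2 + c3 + n + 1 ≠ 0 :=
      h123.ne_zero (n + m + 2 + n + 1) (by push_cast; ring)
    have e5 : c2 + 1 + n ≠ 0 := h2.ne_zero (1 + n) (by push_cast; ring)
    have e6 : (m : ℝ) + 1 ≠ 0 := by positivity
    have e7 : (n : ℝ) + 1 ≠ 0 := by positivity
    rw [← mul_assoc, Cp_mul_upRatio (h23.ne_zero (2 * n + 3) (by push_cast; ring))
      (h3.ne_zero (1 + n) (by push_cast; ring))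
      (h23.ne_zero (n + (n + m) + 2) (by push_cast; ring))
      (h23.ne_zero (n + (n + m) + 3) (by push_cast; ring)), nextRatio,
      show (n : ℝ) + 1 + m + 2 + c1 + c2 + c3 + n = n + m + 2 + c1 + c2 + c3 + n + 1 by ring,
      show (n : ℝ) + m + 1 - n = m + 1 by ring, show (n : ℝ) + 1 - n = 1 by ring,
      show c2 + c3 + (n : ℝ) + 1 + n = 2 * n + c2 + c3 + 1 by ring,
      show -((n : ℝ) + 1) + n = -1 by ring,
      show (n : ℝ) + 1 + c2 + c3 + 1 + n = 2 * n + c2 + c3 + 2 by ring,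
      show -((n : ℝ) + 1 + m) + n = -(m + 1) by ring]
    generalize (n : ℝ) + m + 2 + c1 + c2 + c3 + n + 1 = y4 at e4 ⊢
    generalize (n : ℝ) + m + 2 + c1 + c2 + c3 + n = y3 at e3 ⊢
    generalize 2 * (n : ℝ) + c2 + c3 + 1 = y1 at e1 ⊢
    generalize 2 * (n : ℝ) + c2 + c3 + 2 = y2 at e2 ⊢
    field_simp
  rw [racah_eq_sum c1 c2 c3 x n m _ _ rfl rfl, hsize, hup,
    racah_pred_eq_sum (x : ℝ) n m h2 h3 h23 h123]
  push_cast
  have hsplit : ∀ (C S A : ℝ) (u r s d b : ℕ → ℝ) (K : ℕ),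
      ∑ k ∈ Finset.range K, u k * (C * r k - S * s k + A * d k) * b k =
        C * ∑ k ∈ Finset.range K, u k * r k * b k - S * ∑ k ∈ Finset.range K, u k * s k * b k +
          A * ∑ k ∈ Finset.range K, u k * d k * b k := fun C S A u r s d b K => by
    rw [Finset.mul_sum, Finset.mul_sum, Finset.mul_sum, ← Finset.sum_sub_distrib,
      ← Finset.sum_add_distrib]
    exact Finset.sum_congr rfl fun k _ => by ring
  rw [hsplit _ _ _ (racahCoeff c1 c2 c3 n m) (fun k => upRatio c1 c2 c3 n m k)
    (fun k => sizeRatio c1 c2 c3 n m k) (fun k => downRatio c1 c2 c3 n m k)] at hsum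
  linear_combination -hsum -
    racahCoeff c1 c2 c3 n m n * racahBasis (c1 + c2) x (n + 1) * htop
end
end

section
/- Let c0, c1, c2, c3, c4 be generic real numbers satisfying c0+c1+c2+c3+c4 = −2N−3 for an integer N ≥ 0. Then for all integers x, j ≥ 0 with x + j ≤ N one has Λ(x; c1,c2; N) / Λ(j; c4,c0; N) = Ω(x; c3,c2,c1; N−j) / Ω(j; c3,c0,c4; N−x). -/
open Finset

noncomputable section

theorem poch_add (a : ℝ) (m n : ℕ) : poch a (m + n) = poch a m * poch (a + m) n := by
  simp only [poch, Finset.prod_range_add, Nat.cast_add, add_assoc]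

theorem poch_neg (a : ℝ) (k : ℕ) : poch (-a) k = (-1) ^ k * poch (a - k + 1) k := by
  rw [poch, poch, ← Finset.prod_range_reflect (fun i : ℕ => a - k + 1 + (i : ℝ)),
    Finset.pow_eq_prod_const, ← Finset.prod_mul_distrib]
  refine Finset.prod_congr rfl fun i hi => ?_
  have hi' : i + 1 ≤ k := Finset.mem_range.mp hi
  rw [Nat.sub_sub, Nat.cast_sub (by omega)]
  push_cast
  ring

theorem Generic.poch_ne_zero {r a : ℝ} (h : Generic r) (m : ℤ) (ha : a = r + m) (k : ℕ) :
    poch a k ≠ 0 := by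
  refine Finset.prod_ne_zero_iff.mpr fun i _ h0 => h (-m - i) ?_
  push_cast
  linarith

theorem Generic.neg_sub_int {r s : ℝ} (h : Generic r) (m : ℤ) (hs : s = -r - m) : Generic s := by
  intro n hn
  refine h (-n - m) ?_
  push_cast
  linarith

/-- The weight `Λ` as a multiple of the normalization `Ω`; the Pochhammer factors of the multiplier
are exchanged by the involution `(x, c1, c2) ↔ (j, c4, c0)`. -/
theorem Lam_eq_mul_Om {c0 c1 c2 c3 c4 : ℝ} {x j r : ℕ}
    (hsum : c0 + c1 + c2 + c3 + c4 = -2 * ((x + j + r : ℕ) : ℝ) - 3)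
    (h3 : poch (c3 + 1) r ≠ 0)
    (h12 : poch (c1 + c2 + (2 * x + r + 2)) j ≠ 0)
    (h04 : poch (c4 + c0 + (2 * j + r + 2)) x ≠ 0) :
    Lam x c1 c2 (x + j + r : ℕ) =
      ((x + j + r).choose x : ℝ) / ((x + r).choose x * poch (c3 + 1) r *
        (poch (c1 + c2 + (2 * x + r + 2)) j * poch (c4 + c0 + (2 * j + r + 2)) x)) *
      Om x c3 c2 c1 (x + r : ℕ) := by
  have hsign : poch (((x + r : ℕ) : ℝ) + 2 + c3 + c2 + c1) x =
      (-1) ^ x * poch (c4 + c0 + (2 * j + r + 2)) x := by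
    rw [show ((x + r : ℕ) : ℝ) + 2 + c3 + c2 + c1 = -(c4 + c0 + (x + 2 * j + r + 1)) by
      push_cast at hsum ⊢; linarith, poch_neg]
    congr 2
    ring
  have hsplit : poch ((x : ℝ) + c1 + c2 + 1) (x + j + r + 1) =
      poch (c2 + c1 + x + 1) (x + r + 1) * poch (c1 + c2 + (2 * x + r + 2)) j := by
    rw [show x + j + r + 1 = x + r + 1 + j by ring, poch_add]
    congr 2 <;> push_cast <;> ring
  have hchoose : ((x + r).choose x : ℝ) ≠ 0 :=
    Nat.cast_ne_zero.mpr (Nat.choose_pos (Nat.le_add_right x r)).ne'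
  have hr : (((x + r : ℕ) : ℤ) - (x : ℤ)).toNat = r := by omega
  simp only [Lam, Om, Int.toNat_natCast, Int.cast_natCast, hr, hsign, hsplit]
  rw [show 2 * (x : ℝ) + c2 + c1 + 1 = 2 * x + c1 + c2 + 1 by ring]
  generalize poch (c1 + 1) x = a, poch (c2 + c1 + x + 1) (x + r + 1) = b
  rcases eq_or_ne a 0 with rfl | ha
  · simp
  rcases eq_or_ne b 0 with rfl | hb
  · simp
  field_simp

theorem choose_div_choose_comm (x j r : ℕ) :
    ((x + j + r).choose x : ℝ) / (x + r).choose x = (x + j + r).choose j / (j + r).choose j := by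
  rw [div_eq_div_iff
    (Nat.cast_ne_zero.mpr (Nat.choose_pos (Nat.le_add_right x r)).ne')
    (Nat.cast_ne_zero.mpr (Nat.choose_pos (Nat.le_add_right j r)).ne')]
  norm_cast
  have h := Nat.choose_mul (n := x + j + r) (k := x + j) (s := x) (by omega)
  have h' := Nat.choose_mul (n := x + j + r) (k := x + j) (s := j) (by omega)
  rw [show x + j + r - x = j + r by omega, Nat.add_sub_cancel_left] at h
  rw [show x + j + r - j = x + r by omega, Nat.add_sub_cancel] at h'
  rw [← h, ← h', Nat.choose_symm_add (a := x)]

/-- ratio identity between the weights `Λ` and the normalizations `Ω`. -/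
theorem lam_om_ratio
    (Nn : ℕ) (c0 c1 c2 c3 c4 : ℝ)
    (hsum : c0+c1+c2+c3+c4 = -2*(Nn:ℝ)-3)
    (hgen : Generic4 c1 c2 c3 c4)
    (x j : ℤ) (hx : 0 ≤ x) (hj : 0 ≤ j) (hxj : x + j ≤ (Nn:ℤ)) :
    Lam x c1 c2 (Nn:ℤ) / Lam j c4 c0 (Nn:ℤ) =
      Om x c3 c2 c1 ((Nn:ℤ) - j) / Om j c3 c0 c4 ((Nn:ℤ) - x) := by
  lift x to ℕ using hx
  lift j to ℕ using hj
  obtain ⟨r, rfl⟩ : ∃ r, Nn = x + j + r := ⟨Nn - (x + j), by omega⟩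
  obtain ⟨-, -, g3, -, g12, -, -, -, -, -, g123, -⟩ := hgen
  have g40 : Generic (c4 + c0) :=
    g123.neg_sub_int (2 * (x + j + r : ℕ) + 3) (by push_cast at hsum ⊢; linarith)
  have h3 : poch (c3 + 1) r ≠ 0 := g3.poch_ne_zero 1 (by simp) r
  have h12 : poch (c1 + c2 + (2 * x + r + 2)) j ≠ 0 :=
    g12.poch_ne_zero (2 * x + r + 2) (by push_cast; ring) j
  have h40 : poch (c4 + c0 + (2 * j + r + 2)) x ≠ 0 :=
    g40.poch_ne_zero (2 * j + r + 2) (by push_cast; ring) x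
  have hLx := Lam_eq_mul_Om hsum h3 h12 h40
  have hLj := Lam_eq_mul_Om (c0 := c2) (c1 := c4) (c2 := c0) (c3 := c3) (c4 := c1)
    (x := j) (j := x) (r := r) (by push_cast at hsum ⊢; linarith) h3 h40 h12
  rw [add_comm j x, mul_comm (poch (c4 + c0 + _) x), mul_assoc, ← div_div,
    ← choose_div_choose_comm] at hLj
  rw [mul_assoc, ← div_div] at hLx
  have hcoef : ((x + j + r).choose x : ℝ) / (x + r).choose x / (poch (c3 + 1) r *
      (poch (c1 + c2 + (2 * x + r + 2)) j * poch (c4 + c0 + (2 * j + r + 2)) x)) ≠ 0 := by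
    have hc1 : ((x + j + r).choose x : ℝ) ≠ 0 :=
      Nat.cast_ne_zero.mpr (Nat.choose_pos (by omega)).ne'
    have hc2 : ((x + r).choose x : ℝ) ≠ 0 :=
      Nat.cast_ne_zero.mpr (Nat.choose_pos (by omega)).ne'
    positivity
  rw [hLx, hLj, mul_div_mul_left _ _ hcoef,
    show ((x + j + r : ℕ) : ℤ) - (j : ℤ) = (x + r : ℕ) by push_cast; ring,
    show ((x + j + r : ℕ) : ℤ) - (x : ℤ) = (j + r : ℕ) by push_cast; ring]
end
end
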